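/- For every δ ∈ (0,1), with probability at least 1 − δ over a sample (x_1,…,x_n) drawn i.i.d. from ν (i.e., from ν^{⊗n}): sup_{φ̂ ∈ Φ} |Ĵ_SC(φ̂) − J_SC(φ̂)| ≤ 2 L_B · Rad_n(Φ, ν) + C_B · √(log(2/δ) / (2n)), where L_B := L'_η · C_Φ + 2 L_η and C_B := L_η · C_Φ + C_η. -/

import Mathlib

open MeasureTheory

/-- Expected Rademacher complexity of a class `F` of real-valued functions on a sample of
size `n` drawn i.i.d. from `ρ`. -/
noncomputable def rademacherComplexity {X : Type*} [MeasurableSpace X] (ρ : Measure X)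
    (n : ℕ) (F : Set (X → ℝ)) : ℝ :=
  ∫ xs : Fin n → X,
    (∑ σ : Fin n → Bool,
        sSup ((fun f : X → ℝ => (∑ i, (if σ i then (1 : ℝ) else -1) * f (xs i)) / n) '' F))
      / 2 ^ n
    ∂(Measure.pi fun _ => ρ)

/-- The sign `±1` encoded by a Boolean. -/
def boolSign (b : Bool) : ℝ := if b then 1 else -1

lemma abs_boolSign (b : Bool) : |boolSign b| = 1 := by
  cases b <;> simp [boolSign]

lemma abs_sum_le_mul {n : ℕ} {a : Fin n → ℝ} {M : ℝ} (h : ∀ i, |a i| ≤ M) :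
    |∑ i, a i| ≤ n * M := by
  calc |∑ i, a i| ≤ ∑ i, |a i| := Finset.abs_sum_le_sum_abs _ _
    _ ≤ ∑ _i : Fin n, M := Finset.sum_le_sum fun i _ => h i
    _ = n * M := by simp

lemma abs_boolSign_mul (b : Bool) (r : ℝ) : |boolSign b * r| = |r| := by
  rw [abs_mul, abs_boolSign, one_mul]

lemma bddAbove_range_of_abs_le {T : Type*} {a : T → ℝ} {M : ℝ} (h : ∀ t, |a t| ≤ M) :
    BddAbove (Set.range a) :=
  ⟨M, by rintro _ ⟨t, rfl⟩; exact (abs_le.1 (h t)).2⟩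

lemma abs_iSup_le_of_abs_le {T : Type*} [Nonempty T] {a : T → ℝ} {M : ℝ} (h : ∀ t, |a t| ≤ M) :
    |⨆ t, a t| ≤ M := by
  obtain ⟨t⟩ := ‹Nonempty T›
  exact abs_le.2 ⟨(abs_le.1 (h t)).1.trans (le_ciSup (bddAbove_range_of_abs_le h) t),
    ciSup_le fun t => (abs_le.1 (h t)).2⟩

section Contraction

variable {T : Type*} [Nonempty T]

lemma iSup_add_iSup_sub_le {a v w : T → ℝ} {A W : ℝ} (ha : ∀ t, |a t| ≤ A)
    (hw : ∀ t, |w t| ≤ W) (hvw : ∀ s t, |v s - v t| ≤ |w s - w t|) :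
    (⨆ t, (a t + v t)) + (⨆ t, (a t - v t)) ≤ (⨆ t, (a t + w t)) + ⨆ t, (a t - w t) := by
  have hp : BddAbove (Set.range fun t => a t + w t) :=
    bddAbove_range_of_abs_le fun t => (abs_add_le _ _).trans (add_le_add (ha t) (hw t))
  have hm : BddAbove (Set.range fun t => a t - w t) :=
    bddAbove_range_of_abs_le fun t => (abs_sub _ _).trans (add_le_add (ha t) (hw t))
  rw [← le_sub_iff_add_le]
  refine ciSup_le fun s => ?_
  rw [le_sub_comm]
  refine ciSup_le fun t => ?_
  have h1 := le_ciSup hp s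
  have h2 := le_ciSup hm s
  have h3 := le_ciSup hp t
  have h4 := le_ciSup hm t
  have h5 := (le_abs_self _).trans (hvw s t)
  rcases abs_cases (w s - w t) with h | h <;> linarith [h.1]

/-- The Ledoux–Talagrand contraction principle (without absolute values), for signs. -/
lemma sum_iSup_boolSign_le {n : ℕ} {a : T → ℝ} {v w : Fin n → T → ℝ} {A W : ℝ}
    (ha : ∀ t, |a t| ≤ A) (hv : ∀ i t, |v i t| ≤ W) (hw : ∀ i t, |w i t| ≤ W)
    (hvw : ∀ i s t, |v i s - v i t| ≤ |w i s - w i t|) :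
    ∑ σ : Fin n → Bool, ⨆ t, (a t + ∑ i, boolSign (σ i) * v i t) ≤
      ∑ σ : Fin n → Bool, ⨆ t, (a t + ∑ i, boolSign (σ i) * w i t) := by
  induction n generalizing a A with
  | zero => simp
  | succ n ih =>
    have key (u : Fin (n + 1) → T → ℝ) :
        ∑ σ : Fin (n + 1) → Bool, ⨆ t, (a t + ∑ i, boolSign (σ i) * u i t) =
          ∑ b : Bool, ∑ τ : Fin n → Bool,
            ⨆ t, (a t + boolSign b * u 0 t + ∑ i, boolSign (τ i) * u i.succ t) := by
      rw [← Fintype.sum_prod_type', ← (Fin.consEquiv fun _ => Bool).sum_comp]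
      refine Finset.sum_congr rfl fun p _ => ?_
      simp [Fin.consEquiv, Fin.sum_univ_succ, add_assoc]
    rw [key v, key w]
    calc ∑ b : Bool, ∑ τ : Fin n → Bool,
            ⨆ t, (a t + boolSign b * v 0 t + ∑ i, boolSign (τ i) * v i.succ t)
        ≤ ∑ b : Bool, ∑ τ : Fin n → Bool,
            ⨆ t, (a t + boolSign b * w 0 t + ∑ i, boolSign (τ i) * v i.succ t) := by
          rw [Finset.sum_comm, Finset.sum_comm (s := (Finset.univ : Finset Bool))]
          refine Finset.sum_le_sum fun τ _ => ?_
          have h := iSup_add_iSup_sub_le (a := fun t => a t + ∑ i, boolSign (τ i) * v i.succ t)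
            (A := A + n * W) (v := v 0) (w := w 0)
            (fun t => (abs_add_le _ _).trans (add_le_add (ha t) (abs_sum_le_mul fun i => by
              rw [abs_boolSign_mul]; exact hv _ _))) (hw 0) (hvw 0)
          have hswap (u : T → ℝ) (b : Bool) (t : T) :
              a t + boolSign b * u t + ∑ i, boolSign (τ i) * v i.succ t =
                a t + ∑ i, boolSign (τ i) * v i.succ t + boolSign b * u t := by ring
          have ht : boolSign true = 1 := rfl
          have hf : boolSign false = -1 := rfl
          simp only [hswap, Fintype.sum_bool, ht, hf, one_mul, neg_mul, ← sub_eq_add_neg]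
          exact h
      _ ≤ _ := by
          refine Finset.sum_le_sum fun b _ => ih (A := A + W) (fun t => ?_)
            (fun i => hv i.succ) (fun i => hw i.succ) fun i => hvw i.succ
          refine (abs_add_le _ _).trans (add_le_add (ha t) ?_)
          rw [abs_boolSign_mul]; exact hw _ _

end Contraction

section BoundedDifferences

variable {X : Type*} [MeasurableSpace X] (ν : Measure X) [IsProbabilityMeasure ν]

lemma Measurable.integrable_of_abs_le {Ω : Type*} [MeasurableSpace Ω] {P : Measure Ω}
    [IsFiniteMeasure P] {f : Ω → ℝ} (hf : Measurable f) {M : ℝ} (h : ∀ x, |f x| ≤ M) :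
    Integrable f P :=
  Integrable.of_bound hf.aestronglyMeasurable M (ae_of_all _ h)

lemma integrable_exp_mul_of_abs_le {Ω : Type*} [MeasurableSpace Ω] {P : Measure Ω}
    [IsFiniteMeasure P] {f : Ω → ℝ} (hf : Measurable f) {M : ℝ} (h : ∀ x, |f x| ≤ M) (r : ℝ) :
    Integrable (fun x => Real.exp (r * f x)) P := by
  refine Measurable.integrable_of_abs_le (by fun_prop) (M := Real.exp (|r| * M)) fun x => ?_
  rw [Real.abs_exp, Real.exp_le_exp]
  calc r * f x ≤ |r * f x| := le_abs_self _
    _ = |r| * |f x| := abs_mul _ _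
    _ ≤ _ := by gcongr; exact h x

/-- Hoeffding's lemma for a function whose oscillation is at most `c`. -/
lemma integral_exp_sub_integral_le {f : X → ℝ} (hf : Measurable f) {c : ℝ}
    (hc : ∀ x y, f x - f y ≤ c) (r : ℝ) :
    ∫ x, Real.exp (r * (f x - ∫ y, f y ∂ν)) ∂ν ≤ Real.exp (r ^ 2 * c ^ 2 / 8) := by
  obtain ⟨x₀⟩ : Nonempty X := nonempty_of_isProbabilityMeasure ν
  have hb : BddBelow (Set.range f) :=
    ⟨f x₀ - c, by rintro _ ⟨y, rfl⟩; linarith [hc x₀ y]⟩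
  have : Nonempty X := ⟨x₀⟩
  have hmem : ∀ x, f x ∈ Set.Icc (⨅ y, f y) ((⨅ y, f y) + c) := fun x =>
    ⟨ciInf_le hb x, by
      have : f x - c ≤ ⨅ y, f y := le_ciInf fun y => by linarith [hc x y]
      linarith⟩
  have h := (ProbabilityTheory.hasSubgaussianMGF_of_mem_Icc (μ := ν) hf.aemeasurable
    (ae_of_all _ hmem)).mgf_le r
  refine h.trans (le_of_eq ?_)
  congr 1
  simp only [add_sub_cancel_left, NNReal.coe_pow, NNReal.coe_div, coe_nnnorm, NNReal.coe_ofNat,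
    Real.norm_eq_abs, div_pow, sq_abs]
  ring

lemma piFinSuccAbove_zero_symm_apply {n : ℕ} (p : X × (Fin n → X)) :
    (MeasurableEquiv.piFinSuccAbove (fun _ : Fin (n + 1) => X) 0).symm p = Fin.cons p.1 p.2 :=
  Fin.insertNth_zero' _ _

lemma measurable_fin_cons {n : ℕ} :
    Measurable fun p : X × (Fin n → X) => (Fin.cons p.1 p.2 : Fin (n + 1) → X) := by
  simp only [← piFinSuccAbove_zero_symm_apply]
  exact MeasurableEquiv.measurable _

lemma integral_pi_fin_succ {n : ℕ} {G : (Fin (n + 1) → X) → ℝ} (hG : Measurable G) {M : ℝ}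
    (hM : ∀ xs, |G xs| ≤ M) :
    ∫ xs, G xs ∂(Measure.pi fun _ => ν) =
      ∫ xs : Fin n → X, ∫ x, G (Fin.cons x xs) ∂ν ∂(Measure.pi fun _ => ν) := by
  have he := (measurePreserving_piFinSuccAbove (fun _ : Fin (n + 1) => ν) 0).symm
  rw [← he.integral_comp', integral_prod_symm]
  · simp only [piFinSuccAbove_zero_symm_apply]
  · exact Measurable.integrable_of_abs_le (hG.comp (MeasurableEquiv.measurable _))
      fun p => hM _

/-- McDiarmid's bound on the moment generating function under bounded differences. -/
lemma integral_exp_le_of_bounded_differences {n : ℕ} {F : (Fin n → X) → ℝ} (hF : Measurable F)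
    {M c : ℝ} (hM : ∀ xs, |F xs| ≤ M)
    (hc : ∀ xs i y, F xs - F (Function.update xs i y) ≤ c) (r : ℝ) :
    ∫ xs, Real.exp (r * (F xs - ∫ ys, F ys ∂(Measure.pi fun _ => ν)))
        ∂(Measure.pi fun _ => ν) ≤ Real.exp (n * (r ^ 2 * c ^ 2 / 8)) := by
  induction n generalizing M with
  | zero =>
    have : ∀ xs, F xs = F default := fun xs => by rw [Subsingleton.elim xs default]
    simp [this]
  | succ n ih =>
    set G : (Fin n → X) → ℝ := fun xs => ∫ x, F (Fin.cons x xs) ∂ν with hG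
    have hFc : Measurable fun p : X × (Fin n → X) => F (Fin.cons p.1 p.2) :=
      hF.comp measurable_fin_cons
    have hFx (xs : Fin n → X) : Measurable fun x => F (Fin.cons x xs) :=
      hFc.comp (measurable_id.prodMk measurable_const)
    have hFi (xs : Fin n → X) : Integrable (fun x => F (Fin.cons x xs)) ν :=
      (hFx xs).integrable_of_abs_le fun x => hM _
    have hGm : Measurable G := hFc.stronglyMeasurable.integral_prod_left'.measurable
    have hGM : ∀ xs, |G xs| ≤ M := fun xs => by
      simpa using norm_integral_le_of_norm_le_const (μ := ν) (f := fun x => F (Fin.cons x xs))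
        (C := M) (ae_of_all _ fun x => hM _)
    have hGc : ∀ xs i y, G xs - G (Function.update xs i y) ≤ c := fun xs i y => by
      rw [hG]
      simp only
      rw [← integral_sub (hFi _) (hFi _)]
      calc _ ≤ ∫ _x, c ∂ν := by
            refine integral_mono ((hFi _).sub (hFi _)) (integrable_const _) fun x => ?_
            simp only [Fin.cons_update]
            exact hc _ _ _
        _ = c := by simp
    set m := ∫ ys, F ys ∂(Measure.pi fun _ => ν) with hm
    have hmG : m = ∫ ys, G ys ∂(Measure.pi fun _ => ν) := integral_pi_fin_succ ν hF hM
    have hexpb : ∀ xs, |Real.exp (r * (F xs - m))| ≤ Real.exp (|r| * (M + |m|)) := fun xs => by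
      rw [Real.abs_exp, Real.exp_le_exp]
      calc r * (F xs - m) ≤ |r| * |F xs - m| := by rw [← abs_mul]; exact le_abs_self _
        _ ≤ _ := by gcongr; exact (abs_sub _ _).trans (by gcongr; exact hM _)
    rw [integral_pi_fin_succ ν (by fun_prop) hexpb]
    have hstep (xs : Fin n → X) : ∫ x, Real.exp (r * (F (Fin.cons x xs) - m)) ∂ν ≤
        Real.exp (r ^ 2 * c ^ 2 / 8) * Real.exp (r * (G xs - m)) := by
      have h := integral_exp_sub_integral_le ν (hFx xs) (c := c) (fun x y => by
        simpa using hc (Fin.cons x xs) 0 y) r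
      calc _ = ∫ x, Real.exp (r * (F (Fin.cons x xs) - G xs)) * Real.exp (r * (G xs - m)) ∂ν := by
            congr 1 with x
            rw [← Real.exp_add]; congr 1; ring
        _ ≤ _ := by
            rw [integral_mul_const]
            gcongr
    calc _ ≤ ∫ xs : Fin n → X, Real.exp (r ^ 2 * c ^ 2 / 8) * Real.exp (r * (G xs - m))
            ∂(Measure.pi fun _ => ν) := by
          refine integral_mono ?_ ?_ hstep
          · refine Measurable.integrable_of_abs_le ?_ (M := Real.exp (|r| * (M + |m|)))
              fun xs => ?_
            · have : Measurable fun p : X × (Fin n → X) =>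
                  Real.exp (r * (F (Fin.cons p.1 p.2) - m)) :=
                Real.measurable_exp.comp ((hFc.sub_const m).const_mul r)
              exact this.stronglyMeasurable.integral_prod_left'.measurable
            · simpa using norm_integral_le_of_norm_le_const (μ := ν)
                (f := fun x => Real.exp (r * (F (Fin.cons x xs) - m)))
                (C := Real.exp (|r| * (M + |m|)))
                (ae_of_all _ fun x => hexpb (Fin.cons x xs))
          · exact (integrable_exp_mul_of_abs_le (hGm.sub_const m) (M := M + |m|)
              (fun xs => (abs_sub _ _).trans (by gcongr; exact hGM _)) r).const_mul _
      _ ≤ Real.exp (r ^ 2 * c ^ 2 / 8) * Real.exp (n * (r ^ 2 * c ^ 2 / 8)) := by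
          rw [integral_const_mul, hmG]
          gcongr
          exact ih hGm hGM hGc
      _ = _ := by
          rw [← Real.exp_add]; congr 1; push_cast; ring

/-- McDiarmid's bounded differences inequality (upper tail). -/
lemma measureReal_ge_le_of_bounded_differences {n : ℕ} {F : (Fin n → X) → ℝ} (hF : Measurable F)
    {M c : ℝ} (hM : ∀ xs, |F xs| ≤ M)
    (hc : ∀ xs i y, F xs - F (Function.update xs i y) ≤ c) {ε : ℝ} (hε : 0 ≤ ε) :
    (Measure.pi fun _ => ν).real
        {xs | ε ≤ F xs - ∫ ys, F ys ∂(Measure.pi fun _ => ν)} ≤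
      Real.exp (-(2 * ε ^ 2 / (n * c ^ 2))) := by
  have h : ProbabilityTheory.HasSubgaussianMGF
      (fun xs => F xs - ∫ ys, F ys ∂(Measure.pi fun _ => ν))
      (n * (‖c‖₊ / 2) ^ 2) (Measure.pi fun _ => ν) := by
    refine ⟨fun r => integrable_exp_mul_of_abs_le (hF.sub_const _)
      (fun xs => (abs_sub _ _).trans (add_le_add_left (hM xs) _)) r, fun r => ?_⟩
    refine (integral_exp_le_of_bounded_differences ν hF hM hc r).trans (le_of_eq ?_)
    congr 1
    simp only [NNReal.coe_mul, NNReal.coe_natCast, NNReal.coe_pow, NNReal.coe_div, coe_nnnorm,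
      NNReal.coe_ofNat, Real.norm_eq_abs, div_pow, sq_abs]
    ring
  refine (h.measure_ge_le hε).trans (le_of_eq ?_)
  congr 1
  simp only [NNReal.coe_mul, NNReal.coe_natCast, NNReal.coe_pow, NNReal.coe_div, coe_nnnorm,
    NNReal.coe_ofNat, Real.norm_eq_abs, div_pow, sq_abs]
  rcases eq_or_ne ((n : ℝ) * c ^ 2) 0 with h0 | h0
  · rw [show 2 * ((n : ℝ) * (c ^ 2 / 2 ^ 2)) = (n * c ^ 2) / 2 by ring, h0]; simp
  · have h1 : (n : ℝ) ≠ 0 := left_ne_zero_of_mul h0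
    have h2 : c ^ 2 ≠ 0 := right_ne_zero_of_mul h0
    have h3 : c ≠ 0 := by rintro rfl; simp at h2
    field_simp

end BoundedDifferences

section Symmetrization

variable {X T : Type*}

lemma abs_sum_boolSign_mul_le {n : ℕ} {h : T → X → ℝ} {M : ℝ} (hM : ∀ t x, |h t x| ≤ M)
    (σ : Fin n → Bool) (xs : Fin n → X) (t : T) :
    |∑ i, boolSign (σ i) * h t (xs i)| ≤ n * M :=
  abs_sum_le_mul fun i => by rw [abs_boolSign_mul]; exact hM _ _

/-- The supremum of a family of functions over a sample, weighted by the signs `σ`. -/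
noncomputable def signedSup {n : ℕ} (h : T → X → ℝ) (σ : Fin n → Bool) (xs : Fin n → X) : ℝ :=
  ⨆ t, ∑ i, boolSign (σ i) * h t (xs i)

lemma abs_signedSup_le [Nonempty T] {n : ℕ} {h : T → X → ℝ} {M : ℝ} (hM : ∀ t x, |h t x| ≤ M)
    (σ : Fin n → Bool) (xs : Fin n → X) : |signedSup h σ xs| ≤ n * M :=
  abs_iSup_le_of_abs_le fun t => abs_sum_boolSign_mul_le hM σ xs t

variable [MeasurableSpace X] [Countable T]

lemma measurable_signedSup {n : ℕ} {h : T → X → ℝ} (hh : ∀ t, Measurable (h t))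
    (σ : Fin n → Bool) : Measurable (signedSup h σ) :=
  Measurable.iSup fun t => Finset.measurable_fun_sum _ fun i _ =>
    ((hh t).comp (measurable_pi_apply i)).const_mul _

variable [Nonempty T] (ν : Measure X) [IsProbabilityMeasure ν]

/-- Exchanging the coordinates selected by `σ` between two independent samples preserves their
joint law. -/
lemma measurePreserving_swap_coordinates {n : ℕ} (σ : Fin n → Bool) :
    MeasurePreserving
      (fun p : (Fin n → X) × (Fin n → X) =>
        ((fun i => if σ i then p.1 i else p.2 i, fun i => if σ i then p.2 i else p.1 i) :
          (Fin n → X) × (Fin n → X)))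
      ((Measure.pi fun _ => ν).prod (Measure.pi fun _ => ν))
      ((Measure.pi fun _ => ν).prod (Measure.pi fun _ => ν)) := by
  have he := measurePreserving_arrowProdEquivProdArrow X X (Fin n) (fun _ => ν) (fun _ => ν)
  have hs : MeasurePreserving
      (fun (z : Fin n → X × X) i => (if σ i then id else Prod.swap : X × X → X × X) (z i))
      (Measure.pi fun _ => ν.prod ν) (Measure.pi fun _ => ν.prod ν) := by
    refine measurePreserving_pi _ _ fun i => ?_
    cases σ i
    · simpa using Measure.measurePreserving_swap (μ := ν) (ν := ν)
    · simpa using MeasurePreserving.id (ν.prod ν)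
  convert (he.comp hs).comp he.symm using 1
  funext p
  refine Prod.ext (funext fun i => ?_) (funext fun i => ?_) <;>
    cases hσ : σ i <;>
    simp [MeasurableEquiv.arrowProdEquivProdArrow, Equiv.arrowProdEquivProdArrow, hσ]

/-- Symmetrization: the expected supremum of the centred empirical process is at most twice the
(unnormalized) expected Rademacher complexity. -/
lemma integral_iSup_centered_le {n : ℕ} {h : T → X → ℝ} (hh : ∀ t, Measurable (h t)) {M : ℝ}
    (hM : ∀ t x, |h t x| ≤ M) :
    ∫ xs : Fin n → X, ⨆ t, ∑ i, (h t (xs i) - ∫ x, h t x ∂ν) ∂(Measure.pi fun _ => ν) ≤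
      2 * ∫ xs, (∑ σ : Fin n → Bool, signedSup h σ xs) / 2 ^ n ∂(Measure.pi fun _ => ν) := by
  set P : Measure (Fin n → X) := Measure.pi fun _ => ν with hP
  have hm (t : T) : |∫ x, h t x ∂ν| ≤ M := by
    simpa using norm_integral_le_of_norm_le_const (μ := ν) (f := h t) (C := M)
      (ae_of_all _ fun x => hM t x)
  have hi (t : T) : Integrable (h t) ν := (hh t).integrable_of_abs_le (hM t)
  have hAm := fun σ : Fin n → Bool => measurable_signedSup hh σ
  have hAb := fun σ : Fin n → Bool => abs_signedSup_le hM σ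
  have hAi (σ : Fin n → Bool) : Integrable (signedSup h σ) P :=
    (hAm σ).integrable_of_abs_le (hAb σ)
  have hdiff (t : T) (p : (Fin n → X) × (Fin n → X)) :
      |∑ i, (h t (p.1 i) - h t (p.2 i))| ≤ n * (M + M) :=
    abs_sum_le_mul fun i => (abs_sub _ _).trans (add_le_add (hM _ _) (hM _ _))
  set S : (Fin n → X) × (Fin n → X) → ℝ := fun p => ⨆ t, ∑ i, (h t (p.1 i) - h t (p.2 i)) with hS
  have hSm : Measurable S := Measurable.iSup fun t => Finset.measurable_fun_sum _ fun i _ =>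
    ((hh t).comp ((measurable_pi_apply i).comp measurable_fst)).sub
      ((hh t).comp ((measurable_pi_apply i).comp measurable_snd))
  have hSb : ∀ p, |S p| ≤ n * (M + M) := fun p => abs_iSup_le_of_abs_le fun t => hdiff t p
  have hSi : Integrable S (P.prod P) := hSm.integrable_of_abs_le hSb
  have hghost : ∫ xs, ⨆ t, ∑ i, (h t (xs i) - ∫ x, h t x ∂ν) ∂P ≤ ∫ p, S p ∂(P.prod P) := by
    rw [integral_prod _ hSi]
    refine integral_mono ?_ hSi.integral_prod_left fun xs => ciSup_le fun t => ?_
    · refine Measurable.integrable_of_abs_le (M := n * (M + M)) ?_ fun xs =>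
        abs_iSup_le_of_abs_le fun t => abs_sum_le_mul fun i =>
          (abs_sub _ _).trans (add_le_add (hM _ _) (hm _))
      exact Measurable.iSup fun t => Finset.measurable_fun_sum _ fun i _ =>
        ((hh t).comp (measurable_pi_apply i)).sub_const _
    · have hci (i : Fin n) : Integrable (fun ys : Fin n → X => h t (ys i)) P :=
        ((hh t).comp (measurable_pi_apply i)).integrable_of_abs_le fun ys => hM _ _
      have hdi (i : Fin n) : Integrable (fun ys : Fin n → X => h t (xs i) - h t (ys i)) P :=
        (integrable_const _).sub (hci i)
      calc ∑ i, (h t (xs i) - ∫ x, h t x ∂ν)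
          = ∫ ys, ∑ i, (h t (xs i) - h t (ys i)) ∂P := by
            rw [integral_finsetSum _ fun i _ => hdi i]
            refine Finset.sum_congr rfl fun i _ => ?_
            rw [integral_sub (integrable_const _) (hci i), hP,
              integral_comp_eval (μ := fun _ : Fin n => ν) (hh t).aestronglyMeasurable]
            simp
        _ ≤ ∫ ys, S (xs, ys) ∂P := by
            refine integral_mono (integrable_finsetSum _ fun i _ => hdi i)
              ((hSm.comp measurable_prodMk_left).integrable_of_abs_le fun ys => hSb _)
              fun ys => ?_
            exact le_ciSup (bddAbove_range_of_abs_le fun t => hdiff t (xs, ys)) t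
  have hsign (σ : Fin n → Bool) : ∫ p, S p ∂(P.prod P) ≤
      ∫ xs, signedSup h σ xs ∂P + ∫ xs, signedSup h (fun i => !σ i) xs ∂P := by
    have hmp := measurePreserving_swap_coordinates ν σ
    rw [← hmp.map_eq, integral_map hmp.measurable.aemeasurable hSm.aestronglyMeasurable]
    have h1 : Integrable (fun p : (Fin n → X) × (Fin n → X) => signedSup h σ p.1) (P.prod P) :=
      ((hAm _).comp measurable_fst).integrable_of_abs_le fun p => hAb _ _
    have h2 : Integrable (fun p : (Fin n → X) × (Fin n → X) =>
        signedSup h (fun i => !σ i) p.2) (P.prod P) :=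
      ((hAm _).comp measurable_snd).integrable_of_abs_le fun p => hAb _ _
    calc _ ≤ ∫ p, (signedSup h σ p.1 + signedSup h (fun i => !σ i) p.2) ∂(P.prod P) := by
          refine integral_mono ((hSm.comp hmp.measurable).integrable_of_abs_le fun p => hSb _)
            (h1.add h2) fun p => ciSup_le fun t => ?_
          have e : ∑ i, (h t (if σ i then p.1 i else p.2 i) - h t (if σ i then p.2 i else p.1 i)) =
              ∑ i, boolSign (σ i) * h t (p.1 i) + ∑ i, boolSign (!σ i) * h t (p.2 i) := by
            rw [← Finset.sum_add_distrib]
            refine Finset.sum_congr rfl fun i _ => ?_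
            cases σ i <;> simp [boolSign] <;> ring
          refine e.le.trans (add_le_add ?_ ?_)
          · exact le_ciSup (bddAbove_range_of_abs_le (abs_sum_boolSign_mul_le hM σ p.1)) t
          · exact le_ciSup (bddAbove_range_of_abs_le
              (abs_sum_boolSign_mul_le hM (fun i => !σ i) p.2)) t
      _ = _ := by
          rw [integral_add h1 h2, integral_fun_fst, integral_fun_snd]
          simp
  have hflip : ∑ σ : Fin n → Bool, ∫ xs, signedSup h (fun i => !σ i) xs ∂P =
      ∑ σ : Fin n → Bool, ∫ xs, signedSup h σ xs ∂P :=
    (Equiv.arrowCongr (Equiv.refl (Fin n)) Equiv.boolNot).sum_comp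
      fun σ => ∫ xs, signedSup h σ xs ∂P
  have hsum := Finset.sum_le_sum fun (σ : Fin n → Bool) (_ : σ ∈ Finset.univ) => hsign σ
  rw [Finset.sum_add_distrib, hflip] at hsum
  simp only [Finset.sum_const, Finset.card_univ, Fintype.card_pi, Fintype.card_bool,
    Finset.prod_const, Fintype.card_fin, nsmul_eq_mul, Nat.cast_pow, Nat.cast_ofNat] at hsum
  rw [integral_div, integral_finsetSum _ fun σ _ => hAi σ]
  refine hghost.trans ?_
  rw [← mul_div_assoc, le_div_iff₀ (by positivity)]
  linarith

/-- One-sided uniform deviation bound for a family `h` whose increments in the index are dominated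
by those of a family `w`. -/
lemma measureReal_iSup_centered_gt_le {n : ℕ} (hn : 1 ≤ n) {h w : T → X → ℝ}
    (hh : ∀ t, Measurable (h t)) (hwm : ∀ t, Measurable (w t)) {M c : ℝ}
    (hM : ∀ t x, |h t x| ≤ M) (hw : ∀ t x, |w t x| ≤ M)
    (hhw : ∀ x s t, |h s x - h t x| ≤ |w s x - w t x|)
    (hc : ∀ t x y, h t x - h t y ≤ c) {ε : ℝ} (hε : ε ∈ Set.Ioo (0 : ℝ) 1) :
    (Measure.pi fun _ => ν).real {xs : Fin n → X |
        2 * ∫ xs, (∑ σ : Fin n → Bool, signedSup w σ xs) / 2 ^ n ∂(Measure.pi fun _ => ν) +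
          c * Real.sqrt (n * Real.log (1 / ε) / 2) <
        ⨆ t, ∑ i, (h t (xs i) - ∫ x, h t x ∂ν)} ≤ ε := by
  obtain ⟨x₀⟩ : Nonempty X := nonempty_of_isProbabilityMeasure ν
  have hc0 : 0 ≤ c := by
    obtain ⟨t⟩ := ‹Nonempty T›
    simpa using hc t x₀ x₀
  have hm (t : T) : |∫ x, h t x ∂ν| ≤ M := by
    simpa using norm_integral_le_of_norm_le_const (μ := ν) (f := h t) (C := M)
      (ae_of_all _ fun x => hM t x)
  set F : (Fin n → X) → ℝ := fun xs => ⨆ t, ∑ i, (h t (xs i) - ∫ x, h t x ∂ν) with hF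
  have hsb (xs : Fin n → X) (t : T) : |∑ i, (h t (xs i) - ∫ x, h t x ∂ν)| ≤ n * (M + M) :=
    abs_sum_le_mul fun i => (abs_sub _ _).trans (add_le_add (hM _ _) (hm _))
  have hFm : Measurable F := Measurable.iSup fun t => Finset.measurable_fun_sum _ fun i _ =>
    ((hh t).comp (measurable_pi_apply i)).sub_const _
  have hFb : ∀ xs, |F xs| ≤ n * (M + M) := fun xs => abs_iSup_le_of_abs_le (hsb xs)
  have hmean : ∫ xs, F xs ∂(Measure.pi fun _ => ν) ≤
      2 * ∫ xs, (∑ σ : Fin n → Bool, signedSup w σ xs) / 2 ^ n ∂(Measure.pi fun _ => ν) := by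
    refine (integral_iSup_centered_le ν hh hM).trans ?_
    have hg_int {g : T → X → ℝ} (hg : ∀ t, Measurable (g t)) (hgM : ∀ t x, |g t x| ≤ M) :
        Integrable (fun xs => (∑ σ : Fin n → Bool, signedSup g σ xs) / 2 ^ n)
          (Measure.pi fun _ => ν) :=
      (integrable_finsetSum _ fun σ _ => (measurable_signedSup hg σ).integrable_of_abs_le
        (abs_signedSup_le hgM σ)).div_const _
    gcongr ?_ * ?_
    refine integral_mono (hg_int hh hM) (hg_int hwm hw) fun xs => ?_
    simp only
    gcongr ?_ / _
    simpa [signedSup] using sum_iSup_boolSign_le (a := fun _ : T => 0) (A := 0)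
      (v := fun i t => h t (xs i)) (w := fun i t => w t (xs i)) (by simp)
      (fun i t => hM t (xs i)) (fun i t => hw t (xs i)) fun i s t => hhw (xs i) s t
  have hn0 : (0 : ℝ) < n := by exact_mod_cast hn
  have hlog : 0 < Real.log (1 / ε) := Real.log_pos (by rw [lt_div_iff₀ hε.1]; linarith [hε.2])
  rcases hc0.eq_or_lt with rfl | hcpos
  · have hconst : ∀ t x, h t x = ∫ y, h t y ∂ν := fun t x => by
      have : ∀ y, h t y = h t x := fun y => by linarith [hc t x y, hc t y x]
      simp [this]
    have hFz : ∀ xs, F xs = 0 := fun xs => by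
      have (t : T) : ∑ i, (h t (xs i) - ∫ x, h t x ∂ν) = 0 :=
        Finset.sum_eq_zero fun i _ => by rw [← hconst t (xs i), sub_self]
      simp only [hF, this, ciSup_const]
    simp only [hFz, integral_zero] at hmean ⊢
    refine (le_of_eq ?_).trans hε.1.le
    convert measureReal_empty (μ := Measure.pi fun _ : Fin n => ν)
    refine Set.eq_empty_of_forall_notMem fun xs hxs => ?_
    have hlt : _ < F xs := hxs
    rw [hFz, zero_mul, add_zero] at hlt
    exact hmean.not_gt hlt
  · have hdiff : ∀ xs i y, F xs - F (Function.update xs i y) ≤ c := fun xs i y => by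
      rw [sub_le_iff_le_add]
      refine ciSup_le fun t => ?_
      have h1 := le_ciSup (bddAbove_range_of_abs_le (hsb (Function.update xs i y))) t
      have h2 : ∑ j, (h t (xs j) - ∫ x, h t x ∂ν) -
          ∑ j, (h t (Function.update xs i y j) - ∫ x, h t x ∂ν) = h t (xs i) - h t y := by
        rw [← Finset.sum_sub_distrib, Finset.sum_eq_single i]
        · simp
        · intro j _ hj; simp [Function.update_of_ne hj]
        · simp
      linarith [hc t (xs i) y]
    calc _ ≤ (Measure.pi fun _ => ν).real {xs | c * Real.sqrt (n * Real.log (1 / ε) / 2) ≤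
            F xs - ∫ ys, F ys ∂(Measure.pi fun _ => ν)} := by
          refine measureReal_mono fun xs hxs => ?_
          simp only [Set.mem_ofPred_eq] at hxs ⊢
          linarith
      _ ≤ Real.exp (-(2 * (c * Real.sqrt (n * Real.log (1 / ε) / 2)) ^ 2 / (n * c ^ 2))) :=
          measureReal_ge_le_of_bounded_differences ν hFm hFb hdiff (by positivity)
      _ = ε := by
          rw [mul_pow, Real.sq_sqrt (by positivity)]
          have : 2 * (c ^ 2 * (n * Real.log (1 / ε) / 2)) / (n * c ^ 2) = Real.log (1 / ε) := by
            field_simp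
          rw [this, one_div, Real.log_inv, neg_neg, Real.exp_log hε.1]

end Symmetrization

section Bregman

variable {η η' : ℝ → ℝ}

lemma ConvexOn.add_mul_sub_le_of_hasDerivAt (hηc : ConvexOn ℝ Set.univ η)
    (hηd : ∀ t, HasDerivAt η (η' t) t) (s t : ℝ) : η s + η' s * (t - s) ≤ η t := by
  rcases lt_trichotomy s t with h | rfl | h
  · have := hηc.le_slope_of_hasDerivAt trivial trivial h (hηd s)
    rw [slope_def_field, le_div_iff₀ (sub_pos.2 h)] at this
    linarith
  · simp
  · have := hηc.slope_le_of_hasDerivAt trivial trivial h (hηd s)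
    rw [slope_def_field, div_le_iff₀ (sub_pos.2 h)] at this
    linarith

lemma abs_deriv_le_of_lipschitz_on_Icc (hηd : ∀ t, HasDerivAt η (η' t) t) {C L : ℝ} (hC : 0 < C)
    (hηL : ∀ s ∈ Set.Icc (-C) C, ∀ t ∈ Set.Icc (-C) C, |η s - η t| ≤ L * |s - t|) {t : ℝ}
    (ht : t ∈ Set.Icc (-C) C) : |η' t| ≤ L := by
  have hacc : (nhdsWithin t (Set.Icc (-C) C \ {t})).NeBot := by
    have := (uniqueDiffOn_Icc (show -C < C by linarith)) t ht
    rwa [uniqueDiffWithinAt_iff_accPt, accPt_principal_iff_nhdsWithin] at this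
  have hlim := (hasDerivWithinAt_iff_tendsto_slope.1
    ((hηd t).hasDerivWithinAt (s := Set.Icc (-C) C))).abs
  refine le_of_tendsto hlim ?_
  filter_upwards [self_mem_nhdsWithin] with s hs
  have hne : s - t ≠ 0 := sub_ne_zero.2 hs.2
  rw [slope_def_field, abs_div, div_le_iff₀ (abs_pos.2 hne)]
  exact hηL s hs.1 t ht

/-- The integrand of the single-class part of the Bregman objective is Lipschitz. -/
lemma abs_bregman_sub_le (hηd : ∀ t, HasDerivAt η (η' t) t) {C L L' : ℝ}
    (hηL : ∀ s ∈ Set.Icc (-C) C, ∀ t ∈ Set.Icc (-C) C, |η s - η t| ≤ L * |s - t|)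
    (hη'L : ∀ s ∈ Set.Icc (-C) C, ∀ t ∈ Set.Icc (-C) C, |η' s - η' t| ≤ L' * |s - t|)
    {s t : ℝ} (hs : s ∈ Set.Icc (-C) C) (ht : t ∈ Set.Icc (-C) C) :
    |(η' s * s - η s) - (η' t * t - η t)| ≤ (L' * C + 2 * L) * |s - t| := by
  rcases eq_or_ne s t with rfl | hst
  · simp
  have hC : 0 < C := by
    by_contra! h
    exact hst (by linarith [hs.1, hs.2, ht.1, ht.2])
  have h1 := abs_deriv_le_of_lipschitz_on_Icc hηd hC hηL hs
  have h2 : |η' s * (s - t)| ≤ L * |s - t| := by rw [abs_mul]; gcongr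
  have h3 : |(η' s - η' t) * t| ≤ L' * |s - t| * C := by
    rw [abs_mul]
    exact mul_le_mul (hη'L s hs t ht) (abs_le.2 ht) (abs_nonneg _)
      ((abs_nonneg _).trans (hη'L s hs t ht))
  calc |(η' s * s - η s) - (η' t * t - η t)|
      = |η' s * (s - t) + (η' s - η' t) * t - (η s - η t)| := by congr 1; ring
    _ ≤ |η' s * (s - t)| + |(η' s - η' t) * t| + |η s - η t| :=
        (abs_sub _ _).trans (by gcongr; exact abs_add_le _ _)
    _ ≤ (L' * C + 2 * L) * |s - t| := by linarith [hηL s hs t ht]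

/-- By convexity, the integrand of the single-class part of the Bregman objective ranges over an
interval of length `L * C + K`. -/
lemma bregman_mem_Icc (hηd : ∀ t, HasDerivAt η (η' t) t) (hηc : ConvexOn ℝ Set.univ η)
    {C L K : ℝ}
    (hηL : ∀ s ∈ Set.Icc (-C) C, ∀ t ∈ Set.Icc (-C) C, |η s - η t| ≤ L * |s - t|)
    (hηb : ∀ s ∈ Set.Icc (-C) C, |η s| ≤ K) {t : ℝ} (ht : t ∈ Set.Icc (-C) C) :
    η' t * t - η t ∈ Set.Icc (-η 0) (-η 0 + (L * C + K)) := by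
  have hneg : -t ∈ Set.Icc (-C) C := ⟨by linarith [ht.2], by linarith [ht.1]⟩
  have h0 := hηc.add_mul_sub_le_of_hasDerivAt hηd t 0
  have h1 := hηc.add_mul_sub_le_of_hasDerivAt hηd 0 t
  have h2 := hηc.add_mul_sub_le_of_hasDerivAt hηd 0 (-t)
  have h3 := abs_le.1 (hηb t ht)
  have h4 := abs_le.1 (hηb (-t) hneg)
  have h5 : η' t * t ≤ L * C := by
    have hC0 : 0 ≤ C := by linarith [ht.1, ht.2]
    rcases hC0.eq_or_lt with rfl | hC
    · have : t = 0 := by linarith [ht.1, ht.2]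
      simp [this]
    · have h6 := abs_deriv_le_of_lipschitz_on_Icc hηd hC hηL ht
      calc η' t * t ≤ |η' t| * |t| := by rw [← abs_mul]; exact le_abs_self _
        _ ≤ L * C := mul_le_mul h6 (abs_le.2 ht) (abs_nonneg _) ((abs_nonneg _).trans h6)
  constructor <;> linarith

end Bregman

lemma integral_signedSup_const_mul {X : Type*} [MeasurableSpace X] (ν : Measure X)
    {Φ : Set (X → ℝ)} {n : ℕ} (hn : 1 ≤ n) {L : ℝ} (hL : 0 ≤ L ∨ ∀ f ∈ Φ, ∀ x, f x = 0) :
    ∫ xs, (∑ σ : Fin n → Bool, signedSup (fun (f : Φ) x => L * f.1 x) σ xs) / 2 ^ n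
        ∂(Measure.pi fun _ => ν) = n * L * rademacherComplexity ν n Φ := by
  have hn0 : (n : ℝ) ≠ 0 := by exact_mod_cast (Nat.one_le_iff_ne_zero.1 hn)
  rw [rademacherComplexity, ← integral_const_mul]
  congr 1 with xs
  rw [← mul_div_assoc, Finset.mul_sum]
  congr 1
  refine Finset.sum_congr rfl fun σ _ => ?_
  rw [sSup_image', signedSup]
  rcases hL with hL | h0
  · rw [Real.mul_iSup_of_nonneg (by positivity)]
    congr 1 with f
    rw [mul_comm (n : ℝ) L, mul_assoc, mul_div_cancel₀ _ hn0, Finset.mul_sum]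
    refine Finset.sum_congr rfl fun i _ => ?_
    simp only [boolSign]
    ring
  · have : ∀ (f : Φ) x, f.1 x = 0 := fun f x => h0 f.1 f.2 x
    simp [this]

/-- **Uniform deviation bound for the single-class part of the Bregman objective.**
With probability at least `1 − δ` over an i.i.d. sample of size `n` from `ν = p(x|y_s)`,
`sup_{φ̂ ∈ Φ} |Ĵ_SC(φ̂) − J_SC(φ̂)| ≤ 2 L_B Rad_n(Φ, ν) + C_B √(log(2/δ)/(2n))`,
where `L_B = L'_η C_Φ + 2 L_η` and `C_B = L_η C_Φ + C_η`. -/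
theorem bregman_sc_uniform_deviation_bound
    {X : Type*} [MeasurableSpace X] (ν μ : Measure X)
    [IsProbabilityMeasure ν] [IsProbabilityMeasure μ]
    (η η' : ℝ → ℝ) (hηd : ∀ t, HasDerivAt η (η' t) t)
    (hηc : ConvexOn ℝ Set.univ η)
    (Φ : Set (X → ℝ)) (hΦc : Φ.Countable) (hΦne : Φ.Nonempty)
    (hΦm : ∀ f ∈ Φ, Measurable f)
    (CΦ : ℝ) (hΦb : ∀ f ∈ Φ, ∀ x, |f x| ≤ CΦ)
    (Lη Cη Lη' : ℝ)
    (hηL : ∀ s ∈ Set.Icc (-CΦ) CΦ, ∀ t ∈ Set.Icc (-CΦ) CΦ, |η s - η t| ≤ Lη * |s - t|)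
    (hηb : ∀ s ∈ Set.Icc (-CΦ) CΦ, |η s| ≤ Cη)
    (hη'L : ∀ s ∈ Set.Icc (-CΦ) CΦ, ∀ t ∈ Set.Icc (-CΦ) CΦ, |η' s - η' t| ≤ Lη' * |s - t|)
    (hint : ∀ f ∈ Φ, Integrable (fun x => η' (f x) * f x - η (f x)) ν)
    (n : ℕ) (hn : 1 ≤ n) (δ : ℝ) (hδ : δ ∈ Set.Ioo (0 : ℝ) 1) :
    ENNReal.ofReal (1 - δ) ≤
      (Measure.pi fun _ : Fin n => ν)
        {xs | sSup ((fun f =>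
              |(1 / n : ℝ) * ∑ i, (η' (f (xs i)) * f (xs i) - η (f (xs i))) -
                ∫ x, (η' (f x) * f x - η (f x)) ∂ν|) '' Φ) ≤
          2 * (Lη' * CΦ + 2 * Lη) * rademacherComplexity ν n Φ +
            (Lη * CΦ + Cη) * Real.sqrt (Real.log (2 / δ) / (2 * n))} := by
  have hf_mem : ∀ f ∈ Φ, ∀ x, f x ∈ Set.Icc (-CΦ) CΦ := fun f hf x => abs_le.1 (hΦb f hf x)
  have : Countable Φ := hΦc.to_subtype
  have : Nonempty Φ := hΦne.to_subtype
  obtain ⟨x₀⟩ : Nonempty X := nonempty_of_isProbabilityMeasure ν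
  obtain ⟨f₀, hf₀⟩ := hΦne
  have hCΦ : 0 ≤ CΦ := (abs_nonneg _).trans (hΦb f₀ hf₀ x₀)
  have hn0 : (0 : ℝ) < n := by exact_mod_cast hn
  set LB := Lη' * CΦ + 2 * Lη with hLB
  set CB := Lη * CΦ + Cη with hCB
  set h : Φ → X → ℝ := fun f x => η' (f.1 x) * f.1 x - η (f.1 x) with hh
  set w : Φ → X → ℝ := fun f x => LB * f.1 x with hw
  have hLB0 : 0 ≤ LB ∨ ∀ f ∈ Φ, ∀ x, f x = 0 := by
    rcases hCΦ.eq_or_lt with h0 | hpos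
    · exact Or.inr fun f hf x => abs_nonpos_iff.1 ((hΦb f hf x).trans h0.ge)
    · left
      have m1 : CΦ ∈ Set.Icc (-CΦ) CΦ := ⟨by linarith, le_rfl⟩
      have m2 : -CΦ ∈ Set.Icc (-CΦ) CΦ := ⟨le_rfl, by linarith⟩
      have hd : 0 < |CΦ - -CΦ| := abs_pos.2 (by linarith)
      have h1 := nonneg_of_mul_nonneg_left ((abs_nonneg _).trans (hηL _ m1 _ m2)) hd
      have h2 := nonneg_of_mul_nonneg_left ((abs_nonneg _).trans (hη'L _ m1 _ m2)) hd
      positivity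
  have hη'm : Measurable η' := by
    rw [show η' = deriv η from funext fun t => (hηd t).deriv.symm]
    exact measurable_deriv η
  have hηm : Measurable η :=
    (continuous_iff_continuousAt.2 fun t => (hηd t).continuousAt).measurable
  have hfm (f : Φ) : Measurable f.1 := hΦm f.1 f.2
  have hhm (f : Φ) : Measurable (h f) :=
    ((hη'm.comp (hfm f)).mul (hfm f)).sub (hηm.comp (hfm f))
  have hwm (f : Φ) : Measurable (w f) := (hfm f).const_mul _
  have hrange (f : Φ) (x : X) : h f x ∈ Set.Icc (-η 0) (-η 0 + CB) :=
    bregman_mem_Icc hηd hηc hηL hηb (hf_mem f.1 f.2 x)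
  have hCB0 : 0 ≤ CB := by
    have := hrange ⟨f₀, hf₀⟩ x₀
    linarith [this.1, this.2]
  have hosc (f : Φ) (x y : X) : h f x - h f y ≤ CB := by
    linarith [(hrange f x).2, (hrange f y).1]
  set M := |η 0| + CB + |LB| * CΦ with hM
  have hLC : 0 ≤ |LB| * CΦ := by positivity
  have hhM (f : Φ) (x : X) : |h f x| ≤ M := by
    have h1 := hrange f x
    rw [abs_le]
    constructor <;> linarith [h1.1, h1.2, neg_abs_le (η 0), le_abs_self (η 0)]
  have hwM (f : Φ) (x : X) : |w f x| ≤ M := by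
    have h1 : |w f x| ≤ |LB| * CΦ := by
      rw [hw, abs_mul]
      exact mul_le_mul_of_nonneg_left (hΦb f.1 f.2 x) (abs_nonneg _)
    linarith [abs_nonneg (η 0)]
  have hlip (x : X) (f g : Φ) : |h f x - h g x| ≤ |w f x - w g x| := by
    refine (abs_bregman_sub_le hηd hηL hη'L (hf_mem f.1 f.2 x) (hf_mem g.1 g.2 x)).trans ?_
    rw [hw, ← mul_sub, abs_mul]
    exact mul_le_mul_of_nonneg_right (le_abs_self _) (abs_nonneg _)
  have hδ2 : δ / 2 ∈ Set.Ioo (0 : ℝ) 1 := ⟨by linarith [hδ.1], by linarith [hδ.2]⟩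
  have hup := measureReal_iSup_centered_gt_le ν hn hhm hwm hhM hwM hlip hosc hδ2
  have hdown := measureReal_iSup_centered_gt_le ν hn (h := fun f x => -h f x)
    (fun f => (hhm f).neg) hwm (fun f x => (abs_neg _).trans_le (hhM f x)) hwM
    (fun x f g => by rw [neg_sub_neg, abs_sub_comm]; exact hlip x f g)
    (fun f x y => by rw [neg_sub_neg]; exact hosc f y x) hδ2
  have hsqrt : Real.sqrt (n * Real.log (1 / (δ / 2)) / 2) =
      n * Real.sqrt (Real.log (2 / δ) / (2 * n)) := by
    rw [one_div_div]
    nth_rewrite 2 [← Real.sqrt_sq hn0.le]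
    rw [← Real.sqrt_mul (by positivity)]
    congr 1
    field_simp
  rw [integral_signedSup_const_mul ν hn hLB0, hsqrt] at hup hdown
  set B := 2 * (n * LB * rademacherComplexity ν n Φ) +
    CB * (n * Real.sqrt (Real.log (2 / δ) / (2 * n))) with hB
  have hBn : 2 * LB * rademacherComplexity ν n Φ +
      CB * Real.sqrt (Real.log (2 / δ) / (2 * n)) = B / n := by
    rw [hB]; field_simp
  rw [hBn]
  set P : Measure (Fin n → X) := Measure.pi fun _ => ν with hP
  set U := {xs : Fin n → X | B < ⨆ f, ∑ i, (h f (xs i) - ∫ x, h f x ∂ν)} with hU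
  set D := {xs : Fin n → X | B < ⨆ f, ∑ i, (-h f (xs i) - ∫ x, -h f x ∂ν)} with hD
  set G := {xs : Fin n → X | sSup ((fun f =>
    |(1 / n : ℝ) * ∑ i, (η' (f (xs i)) * f (xs i) - η (f (xs i))) -
      ∫ x, (η' (f x) * f x - η (f x)) ∂ν|) '' Φ) ≤ B / n} with hG
  have hmean (g : X → ℝ) (hg : ∀ x, |g x| ≤ M) : |∫ x, g x ∂ν| ≤ M := by
    simpa using norm_integral_le_of_norm_le_const (μ := ν) (f := g) (C := M) (ae_of_all _ hg)
  have hbdd (g : Φ → X → ℝ) (hg : ∀ f x, |g f x| ≤ M) (xs : Fin n → X) :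
      BddAbove (Set.range fun f => ∑ i, (g f (xs i) - ∫ x, g f x ∂ν)) :=
    bddAbove_range_of_abs_le (M := n * (M + M)) fun f => abs_sum_le_mul fun i =>
      (abs_sub _ _).trans (add_le_add (hg f _) (hmean _ (hg f)))
  have hcover : Set.univ ⊆ G ∪ (U ∪ D) := by
    intro xs _
    by_contra hxs
    simp only [Set.mem_union, not_or] at hxs
    obtain ⟨hxG, hxU, hxD⟩ := hxs
    refine hxG ?_
    have hu : ⨆ f, ∑ i, (h f (xs i) - ∫ x, h f x ∂ν) ≤ B := not_lt.1 hxU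
    have hd : ⨆ f, ∑ i, (-h f (xs i) - ∫ x, -h f x ∂ν) ≤ B := not_lt.1 hxD
    rw [hG, Set.mem_ofPred_eq]
    rw [sSup_image']
    refine ciSup_le fun f => ?_
    have h1 := (le_ciSup (hbdd h hhM xs) f).trans hu
    have h2 := (le_ciSup (hbdd (fun f x => -h f x)
      (fun f x => (abs_neg _).trans_le (hhM f x)) xs) f).trans hd
    simp only [integral_neg, Finset.sum_sub_distrib, Finset.sum_neg_distrib, Finset.sum_const,
      Finset.card_univ, Fintype.card_fin, nsmul_eq_mul] at h1 h2
    have e : (1 / n : ℝ) * ∑ i, h f (xs i) - ∫ x, h f x ∂ν =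
        (∑ i, h f (xs i) - n * ∫ x, h f x ∂ν) / n := by field_simp
    change |(1 / n : ℝ) * ∑ i, h f (xs i) - ∫ x, h f x ∂ν| ≤ B / n
    rw [e, abs_div, abs_of_pos hn0]
    gcongr
    rw [abs_le]
    constructor <;> linarith
  have hone : (1 : ℝ) ≤ P.real G + (P.real U + P.real D) := by
    calc (1 : ℝ) = P.real Set.univ := by simp
      _ ≤ P.real (G ∪ (U ∪ D)) := measureReal_mono hcover
      _ ≤ P.real G + P.real (U ∪ D) := measureReal_union_le _ _
      _ ≤ P.real G + (P.real U + P.real D) := by gcongr; exact measureReal_union_le _ _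
  exact ENNReal.ofReal_le_of_le_toReal (by change 1 - δ ≤ P.real G; linarith)
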